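/- Let u, v ≥ 3 be integers and let M = [[a,b],[c,d]] ∈ 𝒢_{u,v} (so that a ≠ 0 and d ≠ 0). Then f(C(c/a)) satisfies the (v,u)-divisibility property if and only if f(C(b/d)) satisfies the (u,v)-divisibility property. -/

import Mathlib

open Matrix

abbrev SL2Z : Type := Matrix.SpecialLinearGroup (Fin 2) ℤ

/-- The matrix `L_u = [[1,0],[u,1]]` as an element of `SL₂(ℤ)`. -/
def Lmat (u : ℤ) : SL2Z := ⟨!![1, 0; u, 1], by simp [Matrix.det_fin_two_of]⟩

/-- The matrix `R_v = [[1,v],[0,1]]` as an element of `SL₂(ℤ)`. -/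
def Rmat (v : ℤ) : SL2Z := ⟨!![1, v; 0, 1], by simp [Matrix.det_fin_two_of]⟩

/-- `S_{u,v}`: the submonoid of `SL₂(ℤ)` generated by `L_u` and `R_v`. -/
def Smonoid (u v : ℤ) : Submonoid SL2Z := Submonoid.closure {Lmat u, Rmat v}

/-- `G_{u,v}`: the subgroup of `SL₂(ℤ)` generated by `L_u` and `R_v`. -/
def Ggroup (u v : ℤ) : Subgroup SL2Z := Subgroup.closure {Lmat u, Rmat v}

/-- `𝒮_{u,v}`. -/
def scrS (u v : ℤ) : Set SL2Z :=
  {M | 0 ≤ M.1 0 0 ∧ 0 ≤ M.1 0 1 ∧ 0 ≤ M.1 1 0 ∧ 0 ≤ M.1 1 1 ∧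
    M.1 0 0 ≡ 1 [ZMOD (u * v)] ∧ M.1 1 1 ≡ 1 [ZMOD (u * v)] ∧
    v ∣ M.1 0 1 ∧ u ∣ M.1 1 0}

/-- `𝒢_{u,v}`. -/
def scrG (u v : ℤ) : Set SL2Z :=
  {M | M.1 0 0 ≡ 1 [ZMOD (u * v)] ∧ M.1 1 1 ≡ 1 [ZMOD (u * v)] ∧
    v ∣ M.1 0 1 ∧ u ∣ M.1 1 0}

/-- Continued fraction value of a list of integers (junk value `0` on `[]`,
division by zero yields junk, as usual in Lean). -/
def E : List ℤ → ℚ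
  | [] => 0
  | [q] => (q : ℚ)
  | q :: l => (q : ℚ) + 1 / E l

/-- The continued fraction value of the list is well defined: the list is
nonempty and no division by zero occurs in the evaluation of `E`. -/
def EWellDef : List ℤ → Prop
  | [] => False
  | [_] => True
  | _ :: l => EWellDef l ∧ E l ≠ 0

/-- Membership in `A₀`: `[q₀,…,q_r]` with `q_i ≠ 0` for `1 ≤ i ≤ r` and
`E([q_i,…,q_r]) ≠ 0` for `0 < i < r`. -/
def memA0 (l : List ℤ) : Prop :=
  l ≠ [] ∧ (∀ i, 0 < i → i < l.length → l.getD i 0 ≠ 0) ∧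
    ∀ i, 0 < i → i + 1 < l.length → E (l.drop i) ≠ 0

/-- Membership in `A₁`: member of `A₀` with `q_i ≥ 1` for `0 < i < r` and
`q_r > 1` when `r > 0`. -/
def memA1 (l : List ℤ) : Prop :=
  memA0 l ∧ (∀ i, 0 < i → i + 1 < l.length → 1 ≤ l.getD i 0) ∧
    (1 < l.length → 1 < l.getD (l.length - 1) 0)

/-- Membership in `A₂`: member of `A₀` with `|q_i| > 1` for `0 < i ≤ r`. -/
def memA2 (l : List ℤ) : Prop :=
  memA0 l ∧ ∀ i, 0 < i → i < l.length → 1 < |l.getD i 0|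

/-- Euclidean-algorithm computation of the short continued fraction of `a/b`. -/
def scfAux (a : ℤ) (b : ℕ) : List ℤ :=
  if hb : b = 0 then []
  else
    have h0 : 0 ≤ Int.emod a (b : ℤ) := Int.emod_nonneg a (by exact_mod_cast hb)
    have h1 : Int.emod a (b : ℤ) < (b : ℤ) :=
      Int.emod_lt_of_pos a (by exact_mod_cast Nat.pos_of_ne_zero hb)
    if hr : (Int.emod a (b : ℤ)).toNat = 0 then [Int.ediv a (b : ℤ)]
    else Int.ediv a (b : ℤ) :: scfAux (b : ℤ) (Int.emod a (b : ℤ)).toNat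
  termination_by b
  decreasing_by omega

/-- `C x` is the short continued fraction representation of the rational `x`,
i.e. the unique list in `A₁` whose continued fraction value is `x`. -/
def C (x : ℚ) : List ℤ := scfAux x.num x.den

/-- Entrywise negation of a list. -/
def negL (l : List ℤ) : List ℤ := l.map (fun q => -q)

/-- The operation `⊕` on lists. -/
def oplus (a b : List ℤ) : List ℤ :=
  match b with
  | [] => a
  | p :: ps =>
    if p = 0 then a.dropLast ++ (a.getLastD 0 + ps.headD 0) :: ps.tail
    else a ++ (p :: ps)

/-- The function `f : A₁ → A₂`. -/
def f (l : List ℤ) : List ℤ :=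
  if h : (l.tail.dropLast).findIdx (fun q => q == 1) < l.tail.dropLast.length then
    let j := (l.tail.dropLast).findIdx (fun q => q == 1) + 1
    oplus (l.take (j - 1) ++ [l.getD (j - 1) 0 + 1])
      (negL (f ((l.getD (j + 1) 0 + 1) :: l.drop (j + 2))))
  else l
  termination_by l.length
  decreasing_by
    simp only [List.length_dropLast, List.length_tail, List.length_cons,
      List.length_drop] at h ⊢
    omega

/-- The function `g : A₂ → A₁`. -/
def g (l : List ℤ) : List ℤ :=
  if h : (l.tail).findIdx (fun q => decide (q < 0)) < l.tail.length then
    let j := (l.tail).findIdx (fun q => decide (q < 0)) + 1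
    oplus (l.take (j - 1) ++ [l.getD (j - 1) 0 - 1, 1])
      (g (negL ((l.getD j 0 + 1) :: l.drop (j + 1))))
  else l
  termination_by l.length
  decreasing_by
    simp only [negL, List.length_map, List.length_cons, List.length_drop,
      List.length_tail] at h ⊢
    omega

/-- `[q₀,…,q_r]` satisfies the `(u,v)`-divisibility property: `v ∣ q_i` for even
`i` and `u ∣ q_i` for odd `i`. -/
def DivProp (u v : ℤ) (l : List ℤ) : Prop :=
  ∀ i, i < l.length → (i % 2 = 0 → v ∣ l.getD i 0) ∧ (i % 2 = 1 → u ∣ l.getD i 0)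


/-! ### Elementary list facts -/

theorem E_cons (q : ℤ) (l : List ℤ) : E (q :: l) = q + (E l)⁻¹ := by
  cases l <;> simp [E]

theorem E_negL (l : List ℤ) : E (negL l) = -E l := by
  induction l with
  | nil => simp [negL, E]
  | cons q l ih =>
    have h : negL (q :: l) = -q :: negL l := rfl
    rw [h, E_cons, E_cons, ih, inv_neg]
    push_cast
    ring

theorem divProp_cons (u v q : ℤ) (l : List ℤ) :
    DivProp u v (q :: l) ↔ v ∣ q ∧ DivProp v u l := by
  constructor
  · intro h
    refine ⟨by simpa using (h 0 (by simp)).1, fun i hi => ?_⟩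
    have := h (i + 1) (by simpa using hi)
    simp only [List.getD_cons_succ] at this
    exact ⟨fun h0 => this.2 (by omega), fun h1 => this.1 (by omega)⟩
  · rintro ⟨hq, h⟩ i hi
    cases i with
    | zero => simpa using hq
    | succ i =>
      have := h i (by simpa using hi)
      simp only [List.getD_cons_succ]
      exact ⟨fun h0 => this.2 (by omega), fun h1 => this.1 (by omega)⟩

theorem divProp_negL (u v : ℤ) (l : List ℤ) : DivProp u v (negL l) ↔ DivProp u v l := by
  induction l generalizing u v with
  | nil => rfl
  | cons q l ih =>
    have h : negL (q :: l) = -q :: negL l := rfl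
    rw [h, divProp_cons, divProp_cons, ih, dvd_neg]

/-! ### Recursive description of `f` -/

theorem f_singleton (q : ℤ) : f [q] = [q] := by
  rw [f]; simp

theorem oplus_cons (q : ℤ) {a : List ℤ} (ha : a ≠ []) (b : List ℤ) :
    oplus (q :: a) b = q :: oplus a b := by
  obtain ⟨x, xs, rfl⟩ := List.exists_cons_of_ne_nil ha
  cases b with
  | nil => rfl
  | cons p ps => by_cases hp : p = 0 <;> simp [oplus, hp]

theorem f_cons_of_ne_one (q p : ℤ) (l : List ℤ) (hp : p ≠ 1) :
    f (q :: p :: l) = q :: f (p :: l) := by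
  cases l with
  | nil => rw [f, f]; simp
  | cons m l =>
    have hp' : (p == 1) = false := by simpa using hp
    have hd : List.findIdx (fun q => q == 1) (q :: p :: m :: l).tail.dropLast
        = List.findIdx (fun q => q == 1) (p :: m :: l).tail.dropLast + 1 := by
      simp [List.dropLast_cons_cons, List.findIdx_cons, hp']
    have hlen : (q :: p :: m :: l).tail.dropLast.length
        = (p :: m :: l).tail.dropLast.length + 1 := by
      simp
    rw [f, f.eq_def (p :: m :: l)]
    by_cases h : List.findIdx (fun q => q == 1) (p :: m :: l).tail.dropLast
        < (p :: m :: l).tail.dropLast.length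
    · rw [dif_pos h, dif_pos (by omega)]
      simp only [hd, Nat.add_sub_cancel, List.take_succ_cons, List.getD_cons_succ,
        List.drop_succ_cons, List.cons_append]
      rw [oplus_cons _ (by simp)]
    · rw [dif_neg h, dif_neg (by omega)]

theorem f_cons_one (q m : ℤ) (l : List ℤ) :
    f (q :: 1 :: m :: l) = oplus [q + 1] (negL (f ((m + 1) :: l))) := by
  rw [f]
  simp [List.dropLast_cons_cons, List.findIdx_cons]

theorem exists_f_cons (n : ℕ) : ∀ (q : ℤ) (l : List ℤ), l.length ≤ n → (∀ x ∈ l, 1 ≤ x) →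
    ∃ p l', f (q :: l) = p :: l' ∧ q ≤ p := by
  induction n with
  | zero =>
    intro q l hl _
    obtain rfl : l = [] := List.length_eq_zero_iff.mp (by omega)
    exact ⟨q, [], f_singleton q, le_rfl⟩
  | succ n ih =>
    intro q l hl hpos
    match l, hl, hpos with
    | [], _, _ => exact ⟨q, [], f_singleton q, le_rfl⟩
    | p :: l, hl, hpos =>
      by_cases hp : p = 1
      · subst hp
        match l, hl, hpos with
        | [], _, _ => exact ⟨q, [1], by rw [f]; simp, le_rfl⟩
        | m :: l, hl, hpos =>
          obtain ⟨p, l', h, hle⟩ := ih (m + 1) l (by simp at hl; omega)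
            (fun x hx => hpos x (by simp [hx]))
          have hm := hpos m (by simp)
          have hp : p ≠ 0 := by omega
          exact ⟨q + 1, -p :: negL l', by rw [f_cons_one, h]; simp [negL, oplus, hp], by omega⟩
      · exact ⟨q, _, f_cons_of_ne_one q p l hp, le_rfl⟩

theorem f_cons_one_of_pos (q m : ℤ) (l : List ℤ) (hm : 1 ≤ m) (hl : ∀ x ∈ l, 1 ≤ x) :
    f (q :: 1 :: m :: l) = (q + 1) :: negL (f ((m + 1) :: l)) := by
  obtain ⟨p, l', h, hle⟩ := exists_f_cons l.length (m + 1) l le_rfl hl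
  have hp : p ≠ 0 := by omega
  rw [f_cons_one, h]
  simp [negL, oplus, hp]

/-! ### Recursive description of `C` -/

theorem C_intCast (n : ℤ) : C n = [n] := by
  have h1 : Int.emod n 1 = 0 := Int.emod_one n
  have h2 : Int.ediv n 1 = n := Int.ediv_one n
  rw [C, scfAux]
  simp [h1, h2]

theorem num_lt_den_of_lt_one {t : ℚ} (h1 : t < 1) : t.num < t.den := by
  have hd : (0 : ℚ) < t.den := by exact_mod_cast t.den_pos
  have h := Rat.num_div_den t
  rw [← h, div_lt_one hd] at h1
  exact_mod_cast h1

theorem den_inv_lt {n : ℤ} {t : ℚ} (h0 : 0 < t) (h1 : t < 1) : (t⁻¹).den < ((n : ℚ) + t).den := by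
  have hn := Rat.num_pos.mpr h0
  have := num_lt_den_of_lt_one h1
  rw [Rat.den_inv_of_ne_zero h0.ne', Rat.intCast_add_den]
  omega

theorem C_intCast_add {n : ℤ} {t : ℚ} (h0 : 0 < t) (h1 : t < 1) :
    C (n + t) = n :: C t⁻¹ := by
  have hn := Rat.num_pos.mpr h0
  have hlt := num_lt_den_of_lt_one h1
  have hd := t.den_pos
  have hnum : ((n : ℚ) + t).num = t.num + t.den * n := by
    have h := Rat.mul_den_eq_num ((n : ℚ) + t)
    rw [Rat.intCast_add_den, add_mul, Rat.mul_den_eq_num t] at h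
    have h' : n * t.den + t.num = ((n : ℚ) + t).num := by exact_mod_cast h
    linarith
  have hmod : Int.emod (t.num + t.den * n) t.den = t.num := by
    change (t.num + t.den * n) % t.den = t.num
    rw [Int.add_mul_emod_self_left, Int.emod_eq_of_lt hn.le hlt]
  have hdiv : Int.ediv (t.num + t.den * n) t.den = n := by
    change (t.num + t.den * n) / t.den = n
    rw [Int.add_mul_ediv_left _ _ (by omega), Int.ediv_eq_zero_of_lt hn.le hlt, zero_add]
  have hinv : (t⁻¹).num = t.den := by
    rw [Rat.num_inv, Int.sign_eq_one_of_pos hn, one_mul]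
  rw [C, scfAux, C, hinv, Rat.den_inv_of_ne_zero h0.ne', Rat.intCast_add_den, hnum]
  simp only [hmod, hdiv]
  rw [dif_neg (by omega), dif_neg (by omega)]
  congr 2
  omega

theorem eq_intCast_or_exists_fract (x : ℚ) :
    (∃ n : ℤ, x = n) ∨ ∃ (n : ℤ) (t : ℚ), 0 < t ∧ t < 1 ∧ x = n + t := by
  rcases (Int.fract_nonneg x).eq_or_lt with h | h
  · left
    exact ⟨⌊x⌋, by rw [Int.fract] at h; linarith⟩
  · right
    exact ⟨⌊x⌋, Int.fract x, h, Int.fract_lt_one x, (Int.floor_add_fract x).symm⟩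

theorem one_le_of_mem_C (N : ℕ) : ∀ x : ℚ, x.den ≤ N → 1 ≤ x → ∀ q ∈ C x, 1 ≤ q := by
  induction N with
  | zero => intro x hx; have := x.den_pos; omega
  | succ N ih =>
    intro x hx h1 q hq
    rcases eq_intCast_or_exists_fract x with ⟨n, rfl⟩ | ⟨n, t, ht0, ht1, rfl⟩
    · rw [C_intCast] at hq
      obtain rfl : q = n := by simpa using hq
      exact_mod_cast h1
    · rw [C_intCast_add ht0 ht1, List.mem_cons] at hq
      rcases hq with rfl | hq
      · have : (0 : ℚ) < q := by linarith
        have : 0 < q := by exact_mod_cast this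
        omega
      · have := den_inv_lt (n := n) ht0 ht1
        exact ih _ (by omega) ((one_le_inv₀ ht0).mpr ht1.le) q hq

/-- Splitting `C x` for `x ≥ 1` compatibly with the shift `x ↦ x + 1`. -/
theorem exists_C_cons {x : ℚ} (hx : 1 ≤ x) :
    ∃ m l, C x = m :: l ∧ C (x + 1) = (m + 1) :: l := by
  rcases eq_intCast_or_exists_fract x with ⟨n, rfl⟩ | ⟨n, t, ht0, ht1, rfl⟩
  · refine ⟨n, [], C_intCast n, ?_⟩
    rw [← C_intCast]; push_cast; rfl
  · refine ⟨n, C t⁻¹, C_intCast_add ht0 ht1, ?_⟩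
    rw [← C_intCast_add ht0 ht1]
    congr 1
    push_cast
    ring

/-! ### `f ∘ C` is a nearest-integer expansion -/

theorem f_C_intCast (n : ℤ) : f (C n) = [n] := by
  rw [C_intCast, f_singleton]

theorem f_C_add_inv {n : ℤ} {y : ℚ} (hy : 2 ≤ y) : f (C (n + y⁻¹)) = n :: f (C y) := by
  have hy0 : 0 < y := by linarith
  rw [C_intCast_add (inv_pos.mpr hy0) (inv_lt_one_of_one_lt₀ (by linarith)), inv_inv]
  rcases eq_intCast_or_exists_fract y with ⟨m, rfl⟩ | ⟨m, t, ht0, ht1, rfl⟩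
  · have : 2 ≤ m := by exact_mod_cast hy
    rw [C_intCast, f_cons_of_ne_one _ _ _ (by omega)]
  · have : (1 : ℚ) < m := by linarith
    have : 1 < m := by exact_mod_cast this
    rw [C_intCast_add ht0 ht1, f_cons_of_ne_one _ _ _ (by omega)]

theorem f_C_sub_inv {n : ℤ} {y : ℚ} (hy : 2 < y) :
    f (C (n - y⁻¹)) = n :: negL (f (C y)) := by
  have hy0 : 0 < y := by linarith
  have hy1 : 0 < y - 1 := by linarith
  have hx : (n : ℚ) - y⁻¹ = (n - 1 : ℤ) + (1 - y⁻¹) := by push_cast; ring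
  have hi : y⁻¹ < 1 := inv_lt_one_of_one_lt₀ (by linarith)
  have hi0 := inv_pos.mpr hy0
  have ht : (1 - y⁻¹)⁻¹ = (1 : ℤ) + (y - 1)⁻¹ := by
    have : 1 - y⁻¹ = (y - 1) / y := by field_simp
    rw [this]
    push_cast
    field_simp
    ring
  obtain ⟨m, l, h1, h2⟩ := exists_C_cons (x := y - 1) (by linarith)
  have hpos := one_le_of_mem_C _ (y - 1) le_rfl (by linarith)
  rw [h1] at hpos
  rw [sub_add_cancel] at h2
  rw [hx, C_intCast_add (by linarith) (by linarith), ht,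
    C_intCast_add (inv_pos.mpr hy1) (inv_lt_one_of_one_lt₀ (by linarith)), inv_inv, h1,
    f_cons_one_of_pos _ _ _ (hpos m (by simp)) (fun x hx => hpos x (by simp [hx])), h2,
    sub_add_cancel]

theorem eq_intCast_or_exists_inv (x : ℚ) :
    (∃ n : ℤ, x = n) ∨
      ∃ (n : ℤ) (y : ℚ), y.den < x.den ∧ (2 ≤ y ∧ x = n + y⁻¹ ∨ 2 < y ∧ x = n - y⁻¹) := by
  rcases eq_intCast_or_exists_fract x with h | ⟨n, t, ht0, ht1, rfl⟩
  · exact Or.inl h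
  · right
    rcases le_or_gt t (1 / 2) with h | h
    · refine ⟨n, t⁻¹, den_inv_lt ht0 ht1, Or.inl ⟨?_, by rw [inv_inv]⟩⟩
      rw [le_inv_comm₀ (by norm_num) ht0]; linarith
    · have h0 : 0 < 1 - t := by linarith
      refine ⟨n + 1, (1 - t)⁻¹, ?_, Or.inr ⟨?_, by rw [inv_inv]; push_cast; ring⟩⟩
      · have := den_inv_lt (n := n) h0 (by linarith)
        have hd : ((n : ℚ) + (1 - t)).den = ((n : ℚ) + t).den := by
          have : (n : ℚ) + (1 - t) = (2 * n + 1 : ℤ) + -((n : ℚ) + t) := by push_cast; ring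
          rw [this, Rat.intCast_add_den, Rat.den_neg_eq_den]
        omega
      · rw [lt_inv_comm₀ (by norm_num) h0]; linarith

/-! ### Words in the generators -/

/-- `IsWord u v a b c d` says that `[[a,b],[c,d]]` is a product of matrices `L_k` with `u ∣ k`
and `R_k` with `v ∣ k`. -/
inductive IsWord (u v : ℤ) : ℤ → ℤ → ℤ → ℤ → Prop
  | one : IsWord u v 1 0 0 1
  | mulL {a b c d : ℤ} (k : ℤ) (hk : u ∣ k) (h : IsWord u v a b c d) :
      IsWord u v a b (c + k * a) (d + k * b)
  | mulR {a b c d : ℤ} (k : ℤ) (hk : v ∣ k) (h : IsWord u v a b c d) :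
      IsWord u v (a + k * c) (b + k * d) c d

namespace IsWord

variable {u v a b c d : ℤ}

theorem swap (h : IsWord u v a b c d) : IsWord v u d c b a := by
  induction h with
  | one => exact one
  | mulL k hk _ ih => exact ih.mulR k hk
  | mulR k hk _ ih => exact ih.mulL k hk

theorem conj_neg (h : IsWord u v a b c d) : IsWord u v a (-b) (-c) d := by
  induction h with
  | one => simpa using one (u := u) (v := v)
  | mulL k hk _ ih => convert ih.mulL (-k) (by simpa using hk) using 1 <;> ring
  | mulR k hk _ ih => convert ih.mulR (-k) (by simpa using hk) using 1 <;> ring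

theorem mulR_right (h : IsWord u v a b c d) (k : ℤ) (hk : v ∣ k) :
    IsWord u v a (b + k * a) c (d + k * c) := by
  induction h with
  | one => simpa using (one (u := u) (v := v)).mulR k hk
  | mulL j hj _ ih => convert ih.mulL j hj using 1; ring
  | mulR j hj _ ih => convert ih.mulR j hj using 1; ring

theorem det (h : IsWord u v a b c d) : a * d - b * c = 1 := by
  induction h with
  | one => norm_num
  | mulL k _ _ ih => linear_combination ih
  | mulR k _ _ ih => linear_combination ih

theorem dvd (h : IsWord u v a b c d) : u * v ∣ a - 1 ∧ u * v ∣ d - 1 ∧ v ∣ b ∧ u ∣ c := by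
  induction h with
  | one => simp
  | @mulL a b c d k hk _ ih =>
    obtain ⟨ha, hd, hb, hc⟩ := ih
    refine ⟨ha, ?_, hb, hc.add (hk.mul_right a)⟩
    rw [show d + k * b - 1 = (d - 1) + k * b by ring]
    exact hd.add (mul_dvd_mul hk hb)
  | @mulR a b c d k hk _ ih =>
    obtain ⟨ha, hd, hb, hc⟩ := ih
    refine ⟨?_, hd, hb.add (hk.mul_right d), hc⟩
    rw [show a + k * c - 1 = (a - 1) + c * k by ring]
    exact ha.add (mul_dvd_mul hc hk)

end IsWord

/-! ### From divisibility to words -/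

theorem exists_isWord (N : ℕ) : ∀ (u v : ℤ) (x : ℚ), x.den ≤ N → DivProp v u (f (C x)) →
    ∃ a b c d, IsWord u v a b c d ∧
      ((a ≠ 0 ∧ x = (c : ℚ) / a) ∨ (b ≠ 0 ∧ x = (d : ℚ) / b)) := by
  induction N with
  | zero => intro u v x hx; have := x.den_pos; omega
  | succ N ih =>
    intro u v x hx h
    rcases eq_intCast_or_exists_inv x with ⟨n, rfl⟩ | ⟨n, y, hyd, hxy⟩
    · rw [f_C_intCast, divProp_cons] at h
      exact ⟨_, _, _, _, IsWord.one.mulL n h.1, Or.inl ⟨by simp, by simp⟩⟩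
    · have key : ∃ ε : ℤ, (ε = 1 ∨ ε = -1) ∧ 2 ≤ y ∧ x = n + ε * y⁻¹ ∧ u ∣ n ∧
          DivProp u v (f (C y)) := by
        rcases hxy with ⟨hy, rfl⟩ | ⟨hy, rfl⟩
        · rw [f_C_add_inv hy, divProp_cons] at h
          exact ⟨1, Or.inl rfl, hy, by simp, h.1, h.2⟩
        · rw [f_C_sub_inv hy, divProp_cons, divProp_negL] at h
          exact ⟨-1, Or.inr rfl, hy.le, by push_cast; ring, h.1, h.2⟩
      obtain ⟨ε, hε, hy, rfl, hn, hdiv⟩ := key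
      obtain ⟨a, b, c, d, hw, hcol⟩ := ih v u y (by omega) hdiv
      have hy0 : y ≠ 0 := by intro h; rw [h] at hy; norm_num at hy
      have hw' : IsWord u v d (ε * c) (ε * b) a := by
        rcases hε with rfl | rfl
        · simpa using hw.swap
        · simpa using hw.swap.conj_neg
      have hε0 : ε ≠ 0 := by rcases hε with rfl | rfl <;> norm_num
      have hεε : (ε : ℚ) * ε = 1 := by rcases hε with rfl | rfl <;> norm_num
      have hεq : (ε : ℚ) ≠ 0 := by exact_mod_cast hε0
      refine ⟨_, _, _, _, hw'.mulL n hn, ?_⟩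
      rcases hcol with ⟨ha, rfl⟩ | ⟨hb, rfl⟩
      · have hc : c ≠ 0 := by rintro rfl; simp at hy0
        have hcq : (c : ℚ) ≠ 0 := by exact_mod_cast hc
        refine Or.inr ⟨mul_ne_zero hε0 hc, ?_⟩
        push_cast
        field_simp
        linear_combination (a : ℚ) * hεε
      · have hd : d ≠ 0 := by rintro rfl; simp at hy0
        have hdq : (d : ℚ) ≠ 0 := by exact_mod_cast hd
        refine Or.inl ⟨hd, ?_⟩
        push_cast
        field_simp
        ring

/-! ### From words to divisibility -/

/-- Nonzero entries, alternately divisible by `u` and `v`. -/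
def AltDvd (u v : ℤ) : List ℤ → Prop
  | [] => True
  | q :: l => u ∣ q ∧ q ≠ 0 ∧ AltDvd v u l

theorem altDvd_negL (u v : ℤ) (l : List ℤ) (h : AltDvd u v l) : AltDvd u v (negL l) := by
  induction l generalizing u v with
  | nil => trivial
  | cons q l ih => exact ⟨by simpa using h.1, by simpa using h.2.1, ih _ _ h.2.2⟩

theorem AltDvd.divProp {u v : ℤ} {l : List ℤ} (h : AltDvd u v l) : DivProp v u l := by
  induction l generalizing u v with
  | nil => intro i hi; simp at hi
  | cons q l ih => exact (divProp_cons _ _ _ _).mpr ⟨h.1, ih h.2.2⟩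

theorem AltDvd.two_lt_abs_E {u v : ℤ} (hu : 3 ≤ u) (hv : 3 ≤ v) {q : ℤ} {l : List ℤ}
    (h : AltDvd u v (q :: l)) : 2 < |E (q :: l)| := by
  induction l generalizing u v q with
  | nil =>
    have hq := Int.le_of_dvd (abs_pos.mpr h.2.1) ((dvd_abs _ _).mpr h.1)
    have : (3 : ℚ) ≤ |(q : ℚ)| := by exact_mod_cast hu.trans hq
    simp only [E]
    linarith
  | cons p l ih =>
    have hq := Int.le_of_dvd (abs_pos.mpr h.2.1) ((dvd_abs _ _).mpr h.1)
    have hq3 : (3 : ℚ) ≤ |(q : ℚ)| := by exact_mod_cast hu.trans hq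
    have hE := ih hv hu h.2.2
    have hinv : |(E (p :: l))⁻¹| < 1 := by
      rw [abs_inv]
      exact inv_lt_one_of_one_lt₀ (by linarith)
    rw [E_cons]
    have := abs_sub_abs_le_abs_sub (q : ℚ) (-(E (p :: l))⁻¹)
    rw [abs_neg, sub_neg_eq_add] at this
    linarith

theorem f_C_E_of_altDvd (N : ℕ) : ∀ {u v : ℤ}, 3 ≤ u → 3 ≤ v → ∀ (q : ℤ) (l : List ℤ),
    l.length ≤ N → AltDvd u v l → f (C (E (q :: l))) = q :: l := by
  induction N with
  | zero =>
    intro u v _ _ q l hl _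
    obtain rfl : l = [] := List.length_eq_zero_iff.mp (by omega)
    exact f_C_intCast q
  | succ N ih =>
    intro u v hu hv q l hl h
    cases l with
    | nil => exact f_C_intCast q
    | cons p l =>
      have hlen : l.length ≤ N := by simpa using hl
      rw [E_cons]
      rcases lt_abs.mp (h.two_lt_abs_E hu hv) with hE | hE
      · rw [f_C_add_inv hE.le, ih hv hu p l hlen h.2.2]
      · have hneg : E (-p :: negL l) = -E (p :: l) := E_negL (p :: l)
        have hx : (q : ℚ) + (E (p :: l))⁻¹ = q - (E (-p :: negL l))⁻¹ := by
          rw [hneg, inv_neg, sub_neg_eq_add]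
        rw [hx, f_C_sub_inv (by rw [hneg]; exact hE),
          ih hv hu (-p) (negL l) (by simpa [negL] using hlen) (altDvd_negL _ _ _ h.2.2)]
        simp [negL]

theorem IsWord.fst_ne_zero {u v a b c d : ℤ} (hu : 3 ≤ u) (hv : 3 ≤ v)
    (h : IsWord u v a b c d) : a ≠ 0 := by
  rintro rfl
  have := Int.le_of_dvd one_pos (by simpa using h.dvd.1)
  nlinarith

theorem IsWord.exists_altDvd {u v a b c d : ℤ} (hu : 3 ≤ u) (hv : 3 ≤ v)
    (h : IsWord u v a b c d) :
    ∃ q l, u ∣ q ∧ AltDvd v u l ∧ (c : ℚ) / a = E (q :: l) := by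
  induction h with
  | one => exact ⟨0, [], dvd_zero _, trivial, by simp [E]⟩
  | @mulL a b c d k hk hw ih =>
    obtain ⟨q, l, hq, hl, hx⟩ := ih
    have ha : (a : ℚ) ≠ 0 := by exact_mod_cast hw.fst_ne_zero hu hv
    refine ⟨q + k, l, hq.add hk, hl, ?_⟩
    rw [E_cons] at hx ⊢
    push_cast
    rw [add_div, mul_div_cancel_right₀ _ ha, hx]
    ring
  | @mulR a b c d k hk hw ih =>
    obtain ⟨q, l, hq, hl, hx⟩ := ih
    by_cases hc : c = 0
    · subst hc
      exact ⟨0, [], dvd_zero _, trivial, by simp [E]⟩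
    have hcq : (c : ℚ) ≠ 0 := by exact_mod_cast hc
    have hx' : (c : ℚ) / (a + k * c : ℤ) = (k + (E (q :: l))⁻¹)⁻¹ := by
      rw [← hx, inv_div, ← inv_div]
      congr 1
      push_cast
      field_simp
      ring
    rw [hx']
    by_cases hk0 : k = 0
    · exact ⟨q, l, hq, hl, by simp [hk0]⟩
    by_cases hq0 : q = 0
    · subst hq0
      match l, hl with
      | [], _ => exact ⟨0, [k], dvd_zero _, ⟨hk, hk0, trivial⟩, by simp [E]⟩
      | p :: l, hl =>
        have hE : (k : ℚ) + (E (0 :: p :: l))⁻¹ = (p + k : ℤ) + (E l)⁻¹ := by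
          rw [E_cons 0, E_cons p]
          push_cast
          rw [zero_add, inv_inv]
          ring
        rw [hE]
        by_cases hpk : p + k = 0
        · rw [hpk, Int.cast_zero, zero_add, inv_inv]
          match l, hl with
          | [], _ => exact ⟨0, [], dvd_zero _, trivial, by simp [E]⟩
          | m :: l, hl => exact ⟨m, l, hl.2.2.1, hl.2.2.2.2, rfl⟩
        · exact ⟨0, (p + k) :: l, dvd_zero _, ⟨hl.1.add hk, hpk, hl.2.2⟩, by simp [E_cons]⟩
    · exact ⟨0, k :: q :: l, dvd_zero _, ⟨hk, hk0, hq, hq0, hl⟩, by simp [E_cons]⟩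

theorem IsWord.divProp {u v a b c d : ℤ} (hu : 3 ≤ u) (hv : 3 ≤ v)
    (h : IsWord u v a b c d) : DivProp v u (f (C ((c : ℚ) / a))) := by
  obtain ⟨q, l, hq, hl, hx⟩ := h.exists_altDvd hu hv
  rw [hx, f_C_E_of_altDvd _ hv hu q l le_rfl hl]
  exact (divProp_cons _ _ _ _).mpr ⟨hq, hl.divProp⟩

/-! ### The main equivalence -/

theorem eq_or_eq_neg_of_mul_eq_mul {a c p s : ℤ} (h : IsCoprime a c) (h' : IsCoprime p s)
    (heq : c * p = s * a) : p = a ∨ p = -a := by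
  have hap : a ∣ p := h.dvd_of_dvd_mul_left ⟨s, by linarith⟩
  have hpa : p ∣ a := h'.dvd_of_dvd_mul_left ⟨c, by linarith⟩
  exact Int.natAbs_eq_natAbs_iff.mp (Int.natAbs_eq_of_dvd_dvd hpa hap)

theorem isWord_of_divProp {u v a b c d : ℤ} (hu : 3 ≤ u) (hv : 3 ≤ v) (hdet : a * d - b * c = 1)
    (ha : u * v ∣ a - 1) (hb : v ∣ b) (h : DivProp v u (f (C ((c : ℚ) / a)))) :
    IsWord u v a b c d := by
  have ha0 : a ≠ 0 := by
    rintro rfl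
    have := Int.le_of_dvd one_pos (by simpa using ha)
    nlinarith
  have hcop : IsCoprime a c := ⟨d, -b, by linear_combination hdet⟩
  have ha0q : (a : ℚ) ≠ 0 := by exact_mod_cast ha0
  obtain ⟨a', b', c', d', hw, hcol⟩ := exists_isWord _ u v _ le_rfl h
  obtain ⟨ha', -, hb', -⟩ := hw.dvd
  have hdet' := hw.det
  rcases hcol with ⟨h0, hx⟩ | ⟨h0, hx⟩
  · have h0q : (a' : ℚ) ≠ 0 := by exact_mod_cast h0
    rw [div_eq_div_iff ha0q h0q] at hx
    have hx : c * a' = c' * a := by exact_mod_cast hx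
    rcases eq_or_eq_neg_of_mul_eq_mul hcop ⟨d', -b', by linear_combination hdet'⟩ hx
      with rfl | rfl
    · obtain rfl : c = c' := mul_right_cancel₀ h0 hx
      have hk : v ∣ d' * b - b' * d := (hb.mul_left _).sub (hb'.mul_right _)
      convert hw.mulR_right _ hk using 1
      · linear_combination (-b) * hdet' + b' * hdet
      · linear_combination (-d) * hdet' + d' * hdet
    · have : u * v ∣ 2 := by
        rw [show (2 : ℤ) = -((a - 1) + (-a - 1)) by ring]
        exact (ha.add ha').neg_right
      have := Int.le_of_dvd two_pos this
      nlinarith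
  · have h0q : (b' : ℚ) ≠ 0 := by exact_mod_cast h0
    rw [div_eq_div_iff ha0q h0q] at hx
    have hx : c * b' = d' * a := by exact_mod_cast hx
    have hva : v ∣ a := by
      rcases eq_or_eq_neg_of_mul_eq_mul hcop ⟨-c', a', by linear_combination hdet'⟩ hx
        with rfl | rfl
      · exact hb'
      · simpa using hb'
    have hv1 : v ∣ 1 := by
      have := hva.sub ((Dvd.intro_left u rfl).trans ha)
      simpa using this
    have := Int.le_of_dvd one_pos hv1
    omega

theorem divProp_of_divProp {u v a b c d : ℤ} (hu : 3 ≤ u) (hv : 3 ≤ v)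
    (hdet : a * d - b * c = 1) (ha : u * v ∣ a - 1) (hb : v ∣ b)
    (h : DivProp v u (f (C ((c : ℚ) / a)))) : DivProp u v (f (C ((b : ℚ) / d))) :=
  (isWord_of_divProp hu hv hdet ha hb h).swap.divProp hv hu

/-- Proposition oneFracGroup: for integers `u, v ≥ 3` and
`M = [[a,b],[c,d]] ∈ 𝒢_{u,v}`, `f(C(c/a))` satisfies the `(v,u)`-divisibility
property if and only if `f(C(b/d))` satisfies the `(u,v)`-divisibility
property. -/
theorem oneFracGroup (u v : ℤ) (hu : 3 ≤ u) (hv : 3 ≤ v) (M : SL2Z)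
    (hM : M ∈ scrG u v) :
    DivProp v u (f (C ((M.1 1 0 : ℚ) / (M.1 0 0 : ℚ)))) ↔
      DivProp u v (f (C ((M.1 0 1 : ℚ) / (M.1 1 1 : ℚ)))) := by
  obtain ⟨ha, hd, hb, hc⟩ := hM
  have hdet := M.2
  rw [Matrix.det_fin_two] at hdet
  exact ⟨divProp_of_divProp hu hv hdet ha.symm.dvd hb,
    divProp_of_divProp hv hu (by linear_combination hdet)
      (by rw [mul_comm]; exact hd.symm.dvd) hc⟩
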